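/- arXiv:1809.04342 — 2 statements merged into one kernel-verified Lean document; each statement's English description precedes it below -/
import Mathlib

section
/- As s → +∞ through real values, (1/(2s)) · Γ(2s+1)^3/(Γ(s+1)^4 (8s)^{2s}) = (e^{−2s}/(√π s^{3/2})) · (1 − 5/(24s) + 25/(1152s^2) + 3551/(414720s^3)) + O(e^{−2s} s^{−3/2} · s^{−4}). In particular, for positive integers s this gives the asymptotic expansion of (1/(2s)) ((2s)!)^3/((s!)^4 (8s)^{2s}). -/
open Real Filter Asymptotics

/-- The error in Stirling's series for `log Γ(s + 1)` truncated after the `s⁻³` term. -/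
noncomputable def stirlingRemainder (s : ℝ) : ℝ :=
  Real.log (Real.Gamma (s + 1)) -
    ((s + 1 / 2) * Real.log s - s + Real.log (2 * π) / 2 + 1 / (12 * s) - 1 / (360 * s ^ 3))

theorem log_Gamma_add_one {y : ℝ} (hy : 0 < y) :
    Real.log (Real.Gamma (y + 1)) = Real.log (Real.Gamma y) + Real.log y := by
  rw [Real.Gamma_add_one hy.ne', Real.log_mul hy.ne' (Real.Gamma_pos_of_pos hy).ne', add_comm]

theorem tendsto_log_Gamma_sub_stirling {s : ℝ} (hs : 0 < s) :
    Tendsto (fun n : ℕ => Real.log (Real.Gamma (s + n + 1)) -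
      ((s + n + 1 / 2) * Real.log (s + n) - (s + n) + Real.log (2 * π) / 2)) atTop (nhds 0) := by
  have h1 : Tendsto (fun n : ℕ => BohrMollerup.logGammaSeq s n - Real.log (Real.Gamma s))
      atTop (nhds 0) := by
    simpa using (BohrMollerup.tendsto_log_gamma hs).sub_const (Real.log (Real.Gamma s))
  have h2 : Tendsto (fun n : ℕ => Real.log (Stirling.stirlingSeq n) - Real.log (√π))
      atTop (nhds 0) := by
    simpa using (Stirling.tendsto_stirlingSeq_sqrt_pi.log
      (by positivity)).sub_const (Real.log (√π))
  have h3 : Tendsto (fun n : ℕ => (n : ℝ) * Real.log (1 + s / n) - s) atTop (nhds 0) := by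
    simpa using ((Real.tendsto_mul_log_one_add_div_atTop s).comp
      tendsto_natCast_atTop_atTop).sub_const s
  have h4 : Tendsto (fun n : ℕ => (s + 1 / 2) * Real.log (1 + s / n)) atTop (nhds 0) := by
    have h : Tendsto (fun n : ℕ => 1 + s / (n : ℝ)) atTop (nhds 1) := by
      simpa using (tendsto_const_div_atTop_nhds_zero_nat s).const_add 1
    simpa using (h.log one_ne_zero).const_mul (s + 1 / 2)
  have h := ((h2.sub h1).sub h3).sub h4
  simp only [sub_zero] at h
  refine h.congr' ?_
  filter_upwards [eventually_ge_atTop 1] with n hn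
  have hn0 : (0 : ℝ) < n := by exact_mod_cast hn
  have hfac : Real.log (Real.Gamma (s + n + 1)) = Real.log (Real.Gamma s) +
      ∑ m ∈ Finset.range (n + 1), Real.log (s + m) := by
    have := BohrMollerup.f_add_nat_eq (f := fun y => Real.log (Real.Gamma y))
      (fun {y} hy => log_Gamma_add_one hy) hs (n + 1)
    rw [← this]
    push_cast
    rw [add_assoc]
  have hlog : Real.log (s + n) = Real.log n + Real.log (1 + s / n) := by
    rw [← Real.log_mul hn0.ne' (by positivity)]
    congr 1
    field_simp
    ring
  rw [hfac, hlog, Stirling.log_stirlingSeq_formula, BohrMollerup.logGammaSeq,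
    Real.log_mul two_ne_zero hn0.ne', Real.log_div hn0.ne' (Real.exp_ne_zero 1), Real.log_exp,
    Real.log_mul two_ne_zero Real.pi_ne_zero, Real.log_sqrt Real.pi_pos.le]
  ring

theorem tendsto_stirlingRemainder {s : ℝ} (hs : 0 < s) :
    Tendsto (fun n : ℕ => stirlingRemainder (s + n)) atTop (nhds 0) := by
  have ht : Tendsto (fun n : ℕ => (s + n)⁻¹) atTop (nhds 0) :=
    tendsto_inv_atTop_zero.comp (tendsto_atTop_add_const_left _ s tendsto_natCast_atTop_atTop)
  have h := ((tendsto_log_Gamma_sub_stirling hs).sub (ht.const_mul (1 / 12))).add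
    ((ht.pow 3).const_mul (1 / 360))
  simp only [mul_zero, sub_zero, ne_eq, OfNat.ofNat_ne_zero, not_false_eq_true, zero_pow,
    add_zero] at h
  refine h.congr fun n => ?_
  have : s + n ≠ 0 := by positivity
  unfold stirlingRemainder
  field_simp
  ring

theorem isBigO_one_of_continuousAt {f : ℝ → ℝ} {a : ℝ} (hf : ContinuousAt f a) :
    f =O[nhds a] fun _ => (1 : ℝ) :=
  hf.tendsto.isBigO_one ℝ

theorem isBigO_log_one_add_sub_taylor :
    (fun x : ℝ => Real.log (1 + x) - (x - x ^ 2 / 2 + x ^ 3 / 3 - x ^ 4 / 4 + x ^ 5 / 5))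
      =O[nhds 0] fun x => x ^ 6 := by
  refine IsBigO.of_bound 2 ?_
  filter_upwards [Metric.ball_mem_nhds (0 : ℝ) (ε := 1 / 2) (by norm_num)] with x hx
  rw [mem_ball_zero_iff, Real.norm_eq_abs] at hx
  have h := Real.abs_log_sub_add_sum_range_le (x := -x) (by rw [abs_neg]; linarith) 5
  rw [abs_neg] at h
  simp only [Finset.sum_range_succ, Finset.sum_range_zero] at h
  rw [Real.norm_eq_abs, Real.norm_eq_abs, abs_pow]
  calc _ ≤ |x| ^ 6 / (1 - |x|) := by
        convert h using 2
        push_cast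
        ring_nf
    _ ≤ 2 * |x| ^ 6 := by
        rw [div_le_iff₀ (by linarith)]
        nlinarith [pow_nonneg (abs_nonneg x) 6]

theorem isBigO_stirlingRemainder_sub :
    (fun s => stirlingRemainder s - stirlingRemainder (s + 1)) =O[atTop] fun s => s⁻¹ ^ 5 := by
  have hr : (fun x : ℝ => (1 / 6 + 4 / 9 * x + 3 / 8 * x ^ 2 + x ^ 3 / 10) / (1 + x) ^ 3)
      =O[nhds 0] fun _ => (1 : ℝ) :=
    isBigO_one_of_continuousAt (by fun_prop (disch := norm_num))
  have hb : (fun x : ℝ => 1 + x / 2) =O[nhds 0] fun _ => (1 : ℝ) :=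
    isBigO_one_of_continuousAt (by fun_prop)
  have h := (hb.mul isBigO_log_one_add_sub_taylor).add
    (hr.mul (isBigO_refl (fun x : ℝ => x ^ 6) (nhds 0)))
  have h' := (isBigO_refl (fun s : ℝ => s) atTop).mul (h.comp_tendsto tendsto_inv_atTop_zero)
  refine h'.congr' ?_ ?_
  · filter_upwards [eventually_gt_atTop 0] with s hs
    have hs1 : 0 < s + 1 := by linarith
    have hlog : Real.log (1 + s⁻¹) = Real.log (s + 1) - Real.log s := by
      rw [← Real.log_div hs1.ne' hs.ne']
      congr 1
      field_simp
    simp only [Function.comp_apply]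
    rw [hlog, stirlingRemainder, stirlingRemainder, log_Gamma_add_one hs1]
    field_simp
    ring
  · filter_upwards [eventually_gt_atTop 0] with s hs
    simp only [Function.comp_apply]
    field_simp

theorem inv_pow_five_le {s : ℝ} (hs : 1 ≤ s) :
    s⁻¹ ^ 5 ≤ 8 * (s⁻¹ ^ 4 - (s + 1)⁻¹ ^ 4) := by
  have h0 : 0 < s := by linarith
  have key : 8 * (s⁻¹ ^ 4 - (s + 1)⁻¹ ^ 4) - s⁻¹ ^ 5 =
      (8 * s * ((s + 1) ^ 4 - s ^ 4) - (s + 1) ^ 4) / (s ^ 5 * (s + 1) ^ 4) := by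
    field_simp
  have : 0 ≤ 8 * s * ((s + 1) ^ 4 - s ^ 4) - (s + 1) ^ 4 := by
    obtain ⟨t, rfl⟩ : ∃ t, s = 1 + t := ⟨s - 1, by ring⟩
    have ht : 0 ≤ t := by linarith
    ring_nf
    positivity
  have := div_nonneg this (by positivity : 0 ≤ s ^ 5 * (s + 1) ^ 4)
  linarith

theorem isBigO_stirlingRemainder : stirlingRemainder =O[atTop] fun s => s⁻¹ ^ 4 := by
  obtain ⟨C, hC, hbound⟩ := isBigO_stirlingRemainder_sub.exists_pos
  obtain ⟨a, ha⟩ := eventually_atTop.1 hbound.bound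
  refine IsBigO.of_bound (8 * C) ?_
  filter_upwards [eventually_ge_atTop a, eventually_ge_atTop 1] with s hsa hs1
  have step : ∀ t, s ≤ t → |stirlingRemainder t - stirlingRemainder (t + 1)| ≤
      8 * C * t⁻¹ ^ 4 - 8 * C * (t + 1)⁻¹ ^ 4 := fun t ht => by
    have h1 : 1 ≤ t := hs1.trans ht
    have h := ha t (hsa.trans ht)
    rw [Real.norm_eq_abs, Real.norm_of_nonneg (by positivity)] at h
    nlinarith [inv_pow_five_le h1]
  have partial_sum : ∀ n : ℕ, |stirlingRemainder s - stirlingRemainder (s + n)| ≤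
      8 * C * s⁻¹ ^ 4 := by
    intro n
    suffices h : |stirlingRemainder s - stirlingRemainder (s + n)| ≤
        8 * C * s⁻¹ ^ 4 - 8 * C * (s + n)⁻¹ ^ 4 by
      have : 0 ≤ 8 * C * (s + n)⁻¹ ^ 4 := by positivity
      linarith
    induction n with
    | zero => simp
    | succ n ih =>
      have h := step (s + n) (by simp)
      push_cast
      rw [← add_assoc]
      linarith [abs_sub_le (stirlingRemainder s) (stirlingRemainder (s + n))
        (stirlingRemainder (s + n + 1))]
  rw [Real.norm_eq_abs, Real.norm_of_nonneg (by positivity)]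
  have hlim := ((tendsto_stirlingRemainder (by linarith : 0 < s)).const_sub
    (stirlingRemainder s)).abs
  rw [sub_zero] at hlim
  exact le_of_tendsto hlim (Eventually.of_forall partial_sum)

theorem isBigO_exp_cubic_sub :
    (fun x : ℝ => Real.exp (-5 / 24 * x + 29 / 2880 * x ^ 3) -
      (1 - 5 / 24 * x + 25 / 1152 * x ^ 2 + 3551 / 414720 * x ^ 3)) =O[nhds 0]
      fun x => x ^ 4 := by
  have hv : Tendsto (fun x : ℝ => -5 / 24 * x + 29 / 2880 * x ^ 3) (nhds 0) (nhds 0) := by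
    have : ContinuousAt (fun x : ℝ => -5 / 24 * x + 29 / 2880 * x ^ 3) 0 := by fun_prop
    simpa [ContinuousAt] using this
  have hb : (fun x : ℝ => (-5 / 24 + 29 / 2880 * x ^ 2) ^ 4) =O[nhds 0] fun _ => (1 : ℝ) :=
    isBigO_one_of_continuousAt (by fun_prop)
  have hq : (fun x : ℝ => -29 / 13824 + 145 / 663552 * x + 841 / 16588800 * x ^ 2
      - 841 / 79626240 * x ^ 3 + 24389 / 143327232000 * x ^ 5) =O[nhds 0] fun _ => (1 : ℝ) :=
    isBigO_one_of_continuousAt (by fun_prop)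
  have hx := isBigO_refl (fun x : ℝ => x ^ 4) (nhds 0)
  have hv4 : (fun x : ℝ => (-5 / 24 * x + 29 / 2880 * x ^ 3) ^ 4) =O[nhds 0] fun x => x ^ 4 :=
    (hb.mul hx).congr (fun x => by ring) (fun x => by ring)
  refine ((((Real.exp_sub_sum_range_isBigO_pow 4).comp_tendsto hv).trans hv4).add
    ((hq.mul hx).congr_right fun x => by ring)).congr_left fun x => ?_
  simp only [Function.comp_apply, Finset.sum_range_succ, Finset.sum_range_zero, Nat.factorial]
  push_cast
  ring

theorem Gamma_add_one_eq_exp {s : ℝ} (hs : 0 < s) :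
    Real.Gamma (s + 1) = Real.exp ((s + 1 / 2) * Real.log s - s + Real.log (2 * π) / 2 +
      1 / (12 * s) - 1 / (360 * s ^ 3) + stirlingRemainder s) := by
  rw [stirlingRemainder, add_sub_cancel, Real.exp_log (Real.Gamma_pos_of_pos (by linarith))]

theorem Gamma_quotient_eq {s : ℝ} (hs : 0 < s) :
    (1 / (2 * s)) * (Real.Gamma (2 * s + 1)) ^ 3 /
        ((Real.Gamma (s + 1)) ^ 4 * (8 * s) ^ (2 * s)) =
      Real.exp (-2 * s) / (Real.sqrt π * s ^ ((3 : ℝ) / 2)) *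
        (Real.exp (-5 / 24 * s⁻¹ + 29 / 2880 * s⁻¹ ^ 3) *
          Real.exp (3 * stirlingRemainder (2 * s) - 4 * stirlingRemainder s)) := by
  have h2s : 0 < 2 * s := by linarith
  have hG2 := Real.Gamma_pos_of_pos (by linarith : 0 < 2 * s + 1)
  have hG1 := Real.Gamma_pos_of_pos (by linarith : 0 < s + 1)
  refine Real.log_injOn_pos (Set.mem_Ioi.2 (by positivity)) (Set.mem_Ioi.2 (by positivity)) ?_
  have h8 : Real.log 8 = 3 * Real.log 2 := by
    rw [show (8 : ℝ) = 2 ^ 3 by norm_num, Real.log_pow]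
    norm_num
  rw [Real.log_div (by positivity) (by positivity), Real.log_mul (by positivity) (by positivity),
    Real.log_mul (x := Real.Gamma (s + 1) ^ 4) (by positivity) (by positivity),
    Real.log_mul (x := Real.exp (-2 * s) / _) (by positivity) (by positivity),
    Real.log_mul (x := Real.exp (_ + _)) (by positivity) (by positivity),
    Real.log_div (x := Real.exp (-2 * s)) (by positivity) (by positivity),
    Real.log_mul (x := √π) (by positivity) (by positivity),
    Real.log_div one_ne_zero (by positivity), Real.log_pow, Real.log_pow,
    Real.log_rpow (by positivity), Real.log_rpow hs, Real.log_sqrt Real.pi_pos.le,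
    Gamma_add_one_eq_exp hs, Gamma_add_one_eq_exp h2s]
  simp only [Real.log_exp, Real.log_one]
  rw [Real.log_mul (x := 8) (by norm_num) hs.ne', Real.log_mul two_ne_zero hs.ne',
    Real.log_mul two_ne_zero Real.pi_ne_zero, h8]
  push_cast
  field_simp
  ring

theorem stirling_type_expansion :
    (fun s : ℝ => (1 / (2 * s)) * (Real.Gamma (2 * s + 1)) ^ 3 /
          ((Real.Gamma (s + 1)) ^ 4 * (8 * s) ^ (2 * s)) -
        Real.exp (-2 * s) / (Real.sqrt π * s ^ ((3 : ℝ) / 2)) *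
          (1 - 5 / (24 * s) + 25 / (1152 * s ^ 2) + 3551 / (414720 * s ^ 3))) =O[atTop]
      (fun s : ℝ => Real.exp (-2 * s) * s ^ (-(11 : ℝ) / 2)) := by
  have hx : Tendsto (fun s : ℝ => s⁻¹) atTop (nhds 0) := tendsto_inv_atTop_zero
  have hR : (fun s => 3 * stirlingRemainder (2 * s) - 4 * stirlingRemainder s)
      =O[atTop] fun s : ℝ => s⁻¹ ^ 4 := by
    have h2 : (fun s => stirlingRemainder (2 * s)) =O[atTop] fun s : ℝ => s⁻¹ ^ 4 :=
      (isBigO_stirlingRemainder.comp_tendsto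
        (tendsto_id.const_mul_atTop (two_pos : (0 : ℝ) < 2))).trans
        (((isBigO_refl (fun s : ℝ => s⁻¹ ^ 4) atTop).const_mul_left (1 / 16)).congr_left
          fun s => by simp only [Function.comp_apply, id_eq, mul_inv]; ring)
    exact (h2.const_mul_left 3).sub (isBigO_stirlingRemainder.const_mul_left 4)
  have hR0 : Tendsto (fun s => 3 * stirlingRemainder (2 * s) - 4 * stirlingRemainder s)
      atTop (nhds 0) := hR.trans_tendsto (by simpa using hx.pow 4)
  have hexpR : (fun s => Real.exp (3 * stirlingRemainder (2 * s) - 4 * stirlingRemainder s) - 1)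
      =O[atTop] fun s : ℝ => s⁻¹ ^ 4 := by
    have h := (Real.exp_sub_sum_range_isBigO_pow 1).comp_tendsto hR0
    simp only [Finset.sum_range_one, pow_zero, Nat.factorial_zero, Nat.cast_one, div_one,
      pow_one] at h
    exact h.trans hR
  have hb : (fun s : ℝ => Real.exp (-5 / 24 * s⁻¹ + 29 / 2880 * s⁻¹ ^ 3)) =O[atTop]
      fun _ => (1 : ℝ) := by
    have h : ContinuousAt (fun x : ℝ => Real.exp (-5 / 24 * x + 29 / 2880 * x ^ 3)) 0 := by
      fun_prop
    exact (isBigO_one_of_continuousAt h).comp_tendsto hx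
  have hmain := ((hb.mul hexpR).congr_right fun s => one_mul _).add
    (isBigO_exp_cubic_sub.comp_tendsto hx)
  have hpre : (fun s : ℝ => Real.exp (-2 * s) / (Real.sqrt π * s ^ ((3 : ℝ) / 2))) =O[atTop]
      fun s : ℝ => Real.exp (-2 * s) / s ^ ((3 : ℝ) / 2) :=
    ((isBigO_refl _ atTop).const_mul_left (√π)⁻¹).congr_left fun s => by
      field_simp
  refine (hpre.mul hmain).congr' ?_ ?_
  · filter_upwards [eventually_gt_atTop 0] with s hs
    rw [Gamma_quotient_eq hs, ← mul_sub]
    simp only [Function.comp_apply]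
    congr 1
    field_simp
    ring
  · filter_upwards [eventually_gt_atTop 0] with s hs
    rw [show -(11 : ℝ) / 2 = -(3 / 2) - (4 : ℕ) by norm_num, Real.rpow_sub hs,
      Real.rpow_neg hs.le, Real.rpow_natCast]
    field_simp
end

section
/- As s → +∞ through real values, (1/s)(Γ(s+1/2)/Γ(s))^2 = 1 − 1/(4s) + 1/(32s^2) + 1/(128s^3) − 5/(2048s^4) − 23/(8192s^5) + O(s^{−6}). -/
open Real Filter Asymptotics

/-- Midpoint log-convexity of the Gamma function. -/
lemma Gamma_add_half_sq_le {s : ℝ} (hs : 0 < s) :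
    Gamma (s + 1 / 2) ^ 2 ≤ Gamma s * Gamma (s + 1) := by
  have h := Gamma_mul_add_mul_le_rpow_Gamma_mul_rpow_Gamma hs (by linarith : 0 < s + 1)
    (by norm_num : (0 : ℝ) < 1 / 2) (by norm_num : (0 : ℝ) < 1 / 2) (by norm_num)
  rw [show 1 / 2 * s + 1 / 2 * (s + 1) = s + 1 / 2 by ring, ← sqrt_eq_rpow, ← sqrt_eq_rpow] at h
  have h₀ := (Gamma_pos_of_pos (by linarith : 0 < s + 1 / 2)).le
  calc Gamma (s + 1 / 2) ^ 2 ≤ (√(Gamma s) * √(Gamma (s + 1))) ^ 2 := by gcongr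
    _ = Gamma s * Gamma (s + 1) := by
      rw [mul_pow, sq_sqrt (Gamma_pos_of_pos hs).le,
        sq_sqrt (Gamma_pos_of_pos (by linarith : 0 < s + 1)).le]

/-- The normalized squared ratio `(Γ (s + 1/2) / Γ s) ^ 2 / s`. -/
noncomputable def gammaRatio (s : ℝ) : ℝ :=
  (1 / s) * (Gamma (s + 1 / 2) / Gamma s) ^ 2

/-- The asymptotic expansion of `gammaRatio` truncated after the term of order `s⁻⁵`. -/
noncomputable def gammaRatioApprox (s : ℝ) : ℝ :=
  1 - 1 / (4 * s) + 1 / (32 * s ^ 2) + 1 / (128 * s ^ 3) - 5 / (2048 * s ^ 4) -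
    23 / (8192 * s ^ 5)

lemma gammaRatio_le_one {s : ℝ} (hs : 0 < s) : gammaRatio s ≤ 1 := by
  have h := Gamma_add_half_sq_le hs
  have hg := Gamma_pos_of_pos hs
  rw [Gamma_add_one hs.ne'] at h
  rw [gammaRatio, div_pow, div_mul_div_comm, div_le_one (by positivity)]
  linarith

lemma le_gammaRatio {s : ℝ} (hs : 1 / 2 < s) : 1 - 1 / (2 * s) ≤ gammaRatio s := by
  have hs₀ : 0 < s := by linarith
  have h := Gamma_add_half_sq_le (by linarith : 0 < s - 1 / 2)
  have hg := Gamma_pos_of_pos hs₀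
  have hr : Gamma (s + 1 / 2) = (s - 1 / 2) * Gamma (s - 1 / 2) := by
    rw [← Gamma_add_one (by linarith)]
    ring_nf
  rw [sub_add_cancel, show s - 1 / 2 + 1 = s + 1 / 2 by ring] at h
  have h' : (s - 1 / 2) * Gamma s ^ 2 ≤ Gamma (s + 1 / 2) ^ 2 := by
    calc (s - 1 / 2) * Gamma s ^ 2
        ≤ (s - 1 / 2) * (Gamma (s - 1 / 2) * Gamma (s + 1 / 2)) := by
          gcongr
      _ = Gamma (s + 1 / 2) ^ 2 := by rw [hr]; ring
  rw [gammaRatio, div_pow, div_mul_div_comm, le_div_iff₀ (by positivity)]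
  calc (1 - 1 / (2 * s)) * (s * Gamma s ^ 2) = (s - 1 / 2) * Gamma s ^ 2 := by
        field_simp
    _ ≤ 1 * Gamma (s + 1 / 2) ^ 2 := by linarith

lemma tendsto_gammaRatio : Tendsto gammaRatio atTop (nhds 1) := by
  have h : Tendsto (fun s : ℝ => 1 - 1 / (2 * s)) atTop (nhds 1) := by
    have : Tendsto (fun s : ℝ => 1 / (2 * s)) atTop (nhds 0) :=
      (tendsto_id.const_mul_atTop two_pos).const_div_atTop 1
    simpa using this.const_sub 1
  refine tendsto_of_tendsto_of_tendsto_of_le_of_le' h tendsto_const_nhds ?_ ?_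
  · filter_upwards [eventually_gt_atTop (1 / 2)] with s hs using le_gammaRatio hs
  · filter_upwards [eventually_gt_atTop 0] with s hs using gammaRatio_le_one hs

lemma tendsto_gammaRatioApprox : Tendsto gammaRatioApprox atTop (nhds 1) := by
  have h (a b : ℝ) (hb : 0 < b) (n : ℕ) (hn : n ≠ 0) :
      Tendsto (fun s : ℝ => a / (b * s ^ n)) atTop (nhds 0) :=
    ((tendsto_pow_atTop hn).const_mul_atTop hb).const_div_atTop a
  have h₁ := h 1 4 (by norm_num) 1 (by norm_num)
  simp only [pow_one] at h₁
  unfold gammaRatioApprox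
  simpa using ((((h₁.const_sub 1).add (h 1 32 (by norm_num) 2 (by norm_num))).add
    (h 1 128 (by norm_num) 3 (by norm_num))).sub (h 5 2048 (by norm_num) 4 (by norm_num))).sub
    (h 23 8192 (by norm_num) 5 (by norm_num))

lemma gammaRatio_add_one {s : ℝ} (hs : 0 < s) :
    gammaRatio (s + 1) = (1 + 1 / (4 * s * (s + 1))) * gammaRatio s := by
  have hg := (Gamma_pos_of_pos hs).ne'
  rw [gammaRatio, gammaRatio, show s + 1 + 1 / 2 = s + 1 / 2 + 1 by ring,
    Gamma_add_one hs.ne', Gamma_add_one (by linarith : s + 1 / 2 ≠ 0)]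
  field_simp
  ring

lemma gammaRatioApprox_add_one {s : ℝ} (hs : 0 < s) :
    gammaRatioApprox (s + 1) = (1 + 1 / (4 * s * (s + 1))) * gammaRatioApprox s +
      (159 * s ^ 4 + 764 * s ^ 3 + 694 * s ^ 2 + 204 * s + 23) / (32768 * s ^ 6 * (s + 1) ^ 5) := by
  rw [gammaRatioApprox, gammaRatioApprox]
  field_simp
  ring

lemma gammaRatioApprox_defect_le {s : ℝ} (hs : 0 < s) :
    (159 * s ^ 4 + 764 * s ^ 3 + 694 * s ^ 2 + 204 * s + 23) / (32768 * s ^ 6 * (s + 1) ^ 5) ≤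
      1 / s ^ 6 - 1 / (s + 1) ^ 6 := by
  rw [div_sub_div _ _ (by positivity) (by positivity), div_le_div_iff₀ (by positivity)
    (by positivity), ← sub_nonneg]
  have : 0 ≤ s ^ 6 * (s + 1) ^ 5 * (32768 * ((s + 1) ^ 6 - s ^ 6) -
      (159 * s ^ 4 + 764 * s ^ 3 + 694 * s ^ 2 + 204 * s + 23) * (s + 1)) := by
    refine mul_nonneg (by positivity) ?_
    ring_nf
    positivity
  linarith

lemma abs_gammaRatio_sub_approx_le_add {s : ℝ} (hs : 0 < s) :
    |gammaRatio s - gammaRatioApprox s| - 1 / s ^ 6 ≤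
      |gammaRatio (s + 1) - gammaRatioApprox (s + 1)| - 1 / (s + 1) ^ 6 := by
  have hf := gammaRatio_add_one hs
  have hp := gammaRatioApprox_add_one hs
  have he := gammaRatioApprox_defect_le hs
  set e := (159 * s ^ 4 + 764 * s ^ 3 + 694 * s ^ 2 + 204 * s + 23) /
    (32768 * s ^ 6 * (s + 1) ^ 5)
  have he₀ : 0 ≤ e := by positivity
  have hr : 0 ≤ 1 / (4 * s * (s + 1)) := by positivity
  have key : |gammaRatio s - gammaRatioApprox s| ≤
      |gammaRatio (s + 1) - gammaRatioApprox (s + 1)| + e := by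
    calc |gammaRatio s - gammaRatioApprox s|
        ≤ (1 + 1 / (4 * s * (s + 1))) * |gammaRatio s - gammaRatioApprox s| :=
          le_mul_of_one_le_left (abs_nonneg _) (by linarith)
      _ = |(1 + 1 / (4 * s * (s + 1))) * (gammaRatio s - gammaRatioApprox s)| := by
          rw [abs_mul, abs_of_nonneg (by linarith : 0 ≤ 1 + 1 / (4 * s * (s + 1)))]
      _ = |gammaRatio (s + 1) - gammaRatioApprox (s + 1) + e| := by
          rw [hf, hp]
          ring_nf
      _ ≤ |gammaRatio (s + 1) - gammaRatioApprox (s + 1)| + |e| := abs_add_le _ _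
      _ = _ := by rw [abs_of_nonneg he₀]
  linarith

lemma abs_gammaRatio_sub_approx_le {s : ℝ} (hs : 0 < s) :
    |gammaRatio s - gammaRatioApprox s| ≤ 1 / s ^ 6 := by
  set g : ℝ → ℝ := fun t => |gammaRatio t - gammaRatioApprox t| - 1 / t ^ 6 with hg
  have hlim : Tendsto g atTop (nhds 0) := by
    have h₁ := (tendsto_gammaRatio.sub tendsto_gammaRatioApprox).abs
    have h₂ : Tendsto (fun t : ℝ => 1 / t ^ 6) atTop (nhds 0) :=
      (tendsto_pow_atTop (by norm_num)).const_div_atTop 1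
    simpa [hg] using h₁.sub h₂
  have hmono : Monotone fun n : ℕ => g (s + n) := by
    refine monotone_nat_of_le_succ fun n => ?_
    have h := abs_gammaRatio_sub_approx_le_add (by positivity : 0 < s + n)
    rw [add_assoc] at h
    simpa [hg] using h
  have h := hmono.ge_of_tendsto
    (hlim.comp (tendsto_atTop_add_const_left _ s tendsto_natCast_atTop_atTop)) 0
  simpa [hg] using h

theorem gamma_ratio_expansion :
    (fun s : ℝ => (1 / s) * (Real.Gamma (s + 1 / 2) / Real.Gamma s) ^ 2 -
        (1 - 1 / (4 * s) + 1 / (32 * s ^ 2) + 1 / (128 * s ^ 3) - 5 / (2048 * s ^ 4) -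
          23 / (8192 * s ^ 5))) =O[atTop]
      (fun s : ℝ => s ^ (-(6 : ℝ))) := by
  refine IsBigO.of_bound 1 ?_
  filter_upwards [eventually_gt_atTop 0] with s hs
  have h := abs_gammaRatio_sub_approx_le hs
  rw [gammaRatio, gammaRatioApprox] at h
  rw [one_mul, norm_of_nonneg (rpow_nonneg hs.le _), rpow_neg hs.le, ← one_div, norm_eq_abs]
  exact_mod_cast h
end
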